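/- For every x ∈ M∖Ω, d_Ω(x,q) ≤ λ d(x,p), with equality if and only if x lies in the topological boundary ∂Ω. -/

import Mathlib

/-!
Formalization framework for "growth competitions" (after the paper's
Section 2), at the metric-space level.

Since Mathlib does not yet have Riemannian metrics, a complete Riemannian
manifold is represented by a proper (hence complete; Hopf-Rinow) metric
space whose distance is the induced length (intrinsic) metric, and
spherical symmetry about `p` with warping function `G` is expressed through
global geodesic polar normal coordinates `Φ : ℝⁿ ≃ M` with `Φ 0 = p` and
`dist (Φ x) p = ‖x‖`, in which the Riemannian distance is the infimum of
lengths of Lipschitz curves measured in the warped metric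
`g = dr² + G(r)² dθ²`.
-/

open Set Metric Filter MeasureTheory InnerProductGeometry NNReal ENNReal
open scoped RealInnerProductSpace Classical

noncomputable section

namespace GrowthComp

variable {M : Type*} [MetricSpace M]

/-- Length of the path `γ : ℝ → M` over the time interval `[0, T]`
(the total variation of `γ` on `[0, T]`, valued in `ℝ≥0∞`). -/
def pathLength (γ : ℝ → M) (T : ℝ) : ℝ≥0∞ := eVariationOn γ (Set.Icc 0 T)

/-- The intrinsic metric `d_S` of `M ∖ S`: the infimum of lengths of Lipschitz
paths from `x` to `y` avoiding `S` (with `sInf ∅ = ∞`). -/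
def dCompl (S : Set M) (x y : M) : ℝ≥0∞ :=
  sInf {L : ℝ≥0∞ | ∃ (T : ℝ) (γ : ℝ → M), 0 ≤ T ∧ γ 0 = x ∧ γ T = y ∧
    (∃ K : ℝ≥0, LipschitzOnWith K γ (Set.Icc 0 T)) ∧
    (∀ t ∈ Set.Icc 0 T, γ t ∉ S) ∧ L = pathLength γ T}

/-- The distance of `M` is the induced length metric (true for every
complete Riemannian manifold). -/
def IsLengthSpace (M : Type*) [MetricSpace M] : Prop :=
  ∀ x y : M, ENNReal.ofReal (dist x y) = dCompl (∅ : Set M) x y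

/-- A path `γ : [0, T] → M` *avoids* the (time-indexed) family `B`:
it starts at `q`, is `λ`-Lipschitz, and `γ s ∉ B s` for all `s ∈ [0, T]`. -/
def AvoidsB (q : M) (lam : ℝ) (B : ℝ → Set M) (T : ℝ) (γ : ℝ → M) : Prop :=
  γ 0 = q ∧ LipschitzOnWith (Real.toNNReal lam) γ (Set.Icc 0 T) ∧
    ∀ s ∈ Set.Icc 0 T, γ s ∉ B s

/-- A path `η : [0, T] → M` *avoids* the family `A`:
it starts at `p`, is `1`-Lipschitz, and `η s ∉ A s` for all `s ∈ [0, T]`. -/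
def AvoidsA (p : M) (A : ℝ → Set M) (T : ℝ) (η : ℝ → M) : Prop :=
  η 0 = p ∧ LipschitzOnWith 1 η (Set.Icc 0 T) ∧ ∀ s ∈ Set.Icc 0 T, η s ∉ A s

/-- `{A_t, B_t}_{t ≥ 0}` is a *growth competition* between `p` and `q` with
speed ratio `λ`: both families are increasing, `A 0 = {q}`, `B 0 = {p}`, and
for `t > 0`, `A t` is the union of `γ([0,t])` over paths `γ` avoiding `B`
and `B t` is the union of `η([0,t))` over paths `η` avoiding `A`. -/
structure IsGrowthCompetition (p q : M) (lam : ℝ) (A B : ℝ → Set M) : Prop where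
  monoA : ∀ ⦃t₁ t₂ : ℝ⦄, 0 ≤ t₁ → t₁ ≤ t₂ → A t₁ ⊆ A t₂
  monoB : ∀ ⦃t₁ t₂ : ℝ⦄, 0 ≤ t₁ → t₁ ≤ t₂ → B t₁ ⊆ B t₂
  A_zero : A 0 = {q}
  B_zero : B 0 = {p}
  A_eq : ∀ t : ℝ, 0 < t →
    A t = {x | ∃ γ : ℝ → M, AvoidsB q lam B t γ ∧ x ∈ γ '' Set.Icc 0 t}
  B_eq : ∀ t : ℝ, 0 < t →
    B t = {x | ∃ η : ℝ → M, AvoidsA p A t η ∧ x ∈ η '' Set.Ico 0 t}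

/-- `A_∞ = ⋃_{t ≥ 0} A_t`. -/
def Ainfty (A : ℝ → Set M) : Set M := ⋃ t ∈ Set.Ici (0 : ℝ), A t

/-- `B_∞ = ⋃_{t ≥ 0} B_t`. -/
def Binfty (B : ℝ → Set M) : Set M := ⋃ t ∈ Set.Ici (0 : ℝ), B t

/-- The recursively defined sets `Ω_n`:
`Ω_0 = ∅`, `Ω_{n+1} = Ω_n ∪ {x ∈ M ∖ Ω_n | d_{Ω_n}(x, q) > λ d(x, p)}`. -/
def OmegaSeq (p q : M) (lam : ℝ) : ℕ → Set M
  | 0 => ∅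
  | n + 1 => OmegaSeq p q lam n ∪
      {x | x ∉ OmegaSeq p q lam n ∧
        ENNReal.ofReal (lam * dist x p) < dCompl (OmegaSeq p q lam n) x q}

/-- `Ω = ⋃_{n ≥ 1} Ω_n`. -/
def Omega (p q : M) (lam : ℝ) : Set M := ⋃ n : ℕ, OmegaSeq p q lam (n + 1)

/-- `γ` is a unit-speed minimizing geodesic from `x` to `y`, parametrized on
`[0, dist x y]`. -/
def IsMinGeodesicFromTo (γ : ℝ → M) (x y : M) : Prop :=
  γ 0 = x ∧ γ (dist x y) = y ∧
    ∀ s ∈ Set.Icc (0 : ℝ) (dist x y), ∀ t ∈ Set.Icc (0 : ℝ) (dist x y),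
      dist (γ s) (γ t) = |s - t|

/-- `S` is star-shaped about `p`: every minimizing geodesic from `p` to a
point of `S` lies inside `S`. -/
def StarShapedAbout (p : M) (S : Set M) : Prop :=
  ∀ x ∈ S, ∀ γ : ℝ → M, IsMinGeodesicFromTo γ p x →
    ∀ t ∈ Set.Icc (0 : ℝ) (dist p x), γ t ∈ S

/-- `x` is *visible* from `q` through the obstacle `S`: no minimizing
geodesic joining `q` and `x` intersects `S`.  (On a nonpositively curved
simply connected manifold minimizing geodesics are unique, so this matches
"the minimizing geodesic joining `q` and `x` does not intersect `S`".) -/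
def VisibleThrough (S : Set M) (q x : M) : Prop :=
  ∀ γ : ℝ → M, IsMinGeodesicFromTo γ q x →
    ∀ t ∈ Set.Icc (0 : ℝ) (dist q x), γ t ∉ S

/-! ### Spherically symmetric manifolds, via polar normal coordinates -/

/-- Euclidean `n`-space, the model space for polar normal coordinates. -/
abbrev Euc (n : ℕ) : Type := EuclideanSpace ℝ (Fin n)

/-- The norm of the tangent vector `v` at the point `x ∈ ℝⁿ ∖ {0}` in the
spherically symmetric (warped product) metric `g = dr² + G(r)² dθ²`:
`g_x(v,v) = ⟨v, x̂⟩² + (G(‖x‖)²/‖x‖²) (‖v‖² − ⟨v, x̂⟩²)`. -/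
def warpNorm {n : ℕ} (G : ℝ → ℝ) (x v : Euc n) : ℝ :=
  if x = 0 then ‖v‖
  else Real.sqrt (⟪v, ‖x‖⁻¹ • x⟫ ^ 2 +
    (G ‖x‖ / ‖x‖) ^ 2 * (‖v‖ ^ 2 - ⟪v, ‖x‖⁻¹ • x⟫ ^ 2))

/-- The length of a (Lipschitz, hence a.e. differentiable) curve `c` on
`[0, T]` in the warped metric `dr² + G(r)² dθ²`. -/
def warpLength {n : ℕ} (G : ℝ → ℝ) (c : ℝ → Euc n) (T : ℝ) : ℝ≥0∞ :=
  ∫⁻ t in Set.Icc (0 : ℝ) T, ENNReal.ofReal (warpNorm G (c t) (deriv c t))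

/-- `G` is an admissible warping function: positive and smooth on `(0,∞)`,
with `G(r) → 0` and `G(r)/r → 1` as `r → 0⁺`. -/
def IsWarping (G : ℝ → ℝ) : Prop :=
  (∀ r : ℝ, 0 < r → 0 < G r) ∧ ContDiffOn ℝ (⊤ : ℕ∞) G (Set.Ioi 0) ∧
    Tendsto G (nhdsWithin 0 (Set.Ioi 0)) (nhds 0) ∧
    Tendsto (fun r => G r / r) (nhdsWithin 0 (Set.Ioi 0)) (nhds 1)

/-- `Φ : ℝⁿ ≃ M` realizes `M` as spherically symmetric about `p` with
warping function `G`: `Φ` is a global geodesic polar normal coordinate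
chart — `Φ 0 = p` and the radial coordinate is the distance to `p` — and
the Riemannian distance of `M` is the infimum of warped lengths of
Lipschitz curves computed in the chart. -/
def IsSphericallySymmetric {n : ℕ} (p : M) (G : ℝ → ℝ) (Φ : Euc n ≃ M) : Prop :=
  IsWarping G ∧ Φ 0 = p ∧ (∀ x : Euc n, dist (Φ x) p = ‖x‖) ∧
    ∀ x y : Euc n, ENNReal.ofReal (dist (Φ x) (Φ y)) =
      sInf {L : ℝ≥0∞ | ∃ (T : ℝ) (c : ℝ → Euc n), 0 ≤ T ∧ c 0 = x ∧ c T = y ∧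
        (∃ K : ℝ≥0, LipschitzOnWith K c (Set.Icc 0 T)) ∧ L = warpLength G c T}

/-- The angular polar coordinate `θ(x) ∈ S_pM ≅ S^{n-1}` of a point
`x ≠ p`, read off through the polar chart `Φ`. -/
def polarTheta {n : ℕ} {M : Type*} [MetricSpace M] (Φ : Euc n ≃ M) (x : M) : Euc n :=
  ‖Φ.symm x‖⁻¹ • Φ.symm x

/-- Nonpositive sectional curvature for the spherically symmetric metric
`dr² + G(r)² dθ²`: the radial sectional curvature is `−G''/G ≤ 0`,
i.e. `G` is convex, and the tangential one is `(1 − G'²)/G² ≤ 0`,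
i.e. `G' ≥ 1`. -/
def NonposCurvWarping (G : ℝ → ℝ) : Prop :=
  ConvexOn ℝ (Set.Ioi 0) G ∧ ∀ r : ℝ, 0 < r → 1 ≤ deriv G r

/-- `∫₁^∞ dr / G(r) = ∞`.  For a surface of revolution this is, by a theorem
of Milnor cited in the paper, equivalent to parabolicity, i.e. conformal
equivalence to the Euclidean plane. -/
def ParabolicWarping (G : ℝ → ℝ) : Prop :=
  ∫⁻ r in Set.Ici (1 : ℝ), ENNReal.ofReal ((G r)⁻¹) = ⊤

/-- `∫₁^∞ dr / G(r) < ∞`.  For a surface of revolution this is, by a theorem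
of Milnor cited in the paper, equivalent to hyperbolicity, i.e. conformal
equivalence to the hyperbolic plane. -/
def HyperbolicWarping (G : ℝ → ℝ) : Prop :=
  ∫⁻ r in Set.Ici (1 : ℝ), ENNReal.ofReal ((G r)⁻¹) < ⊤

/-- `x` and `y` are joined by a `1`-Lipschitz path defined on `[0, L]` and avoiding `S` (extended to
a `1`-Lipschitz map on the whole line). -/
def JoinedAvoiding (S : Set M) (x y : M) (L : ℝ) : Prop :=
  ∃ G : ℝ → M, LipschitzWith 1 G ∧ G 0 = x ∧ G L = y ∧ ∀ t ∈ Set.Icc 0 L, G t ∉ S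

theorem JoinedAvoiding.dCompl_le {S : Set M} {x y : M} {L : ℝ} (hL : 0 ≤ L)
    (h : JoinedAvoiding S x y L) : dCompl S x y ≤ ENNReal.ofReal L := by
  obtain ⟨G, hG, h0, h1, hS⟩ := h
  have hle : dCompl S x y ≤ pathLength G L :=
    sInf_le ⟨L, G, hL, h0, h1, ⟨1, hG.lipschitzOnWith⟩, hS, rfl⟩
  refine hle.trans ?_
  have := (hG.lipschitzOnWith (s := Set.Icc 0 L)).comp_eVariationOn_le
    (mapsTo_id (Set.Icc (0 : ℝ) L))
  rw [eVariationOn_id_Icc] at this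
  simpa [pathLength] using this

/-- Reparametrization by arc length of a Lipschitz path of length less than `L`. -/
theorem JoinedAvoiding.of_dCompl_lt {S : Set M} {x y : M} {L : ℝ}
    (h : dCompl S x y < ENNReal.ofReal L) : JoinedAvoiding S x y L := by
  obtain ⟨_, ⟨T, γ, hT, rfl, rfl, ⟨K, hK⟩, hS, rfl⟩, hlt⟩ := sInf_lt_iff.1 h
  have hbv := hK.locallyBoundedVariationOn
  set I := Set.Icc 0 T
  have h0 : (0 : ℝ) ∈ I := ⟨le_rfl, hT⟩
  have hTI : T ∈ I := ⟨hT, le_rfl⟩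
  set v := variationOnFromTo γ I 0
  have hdiff : ∀ s ∈ I, ∀ t ∈ I, s ≤ t → v t - v s = (eVariationOn γ (I ∩ Set.Icc s t)).toReal := by
    intro s hs t ht hst
    rw [variationOnFromTo.sub_right hbv h0 ht hs, variationOnFromTo.eq_of_le _ _ hst]
  have hdist : ∀ s ∈ I, ∀ t ∈ I, dist (γ s) (γ t) ≤ dist (v s) (v t) := by
    intro s hs t ht
    wlog hst : s ≤ t generalizing s t
    · rw [dist_comm, dist_comm (v s)]
      exact this t ht s hs (le_of_not_ge hst)
    rw [dist_comm (v s), Real.dist_eq]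
    refine le_trans ?_ (le_abs_self _)
    rw [hdiff s hs t ht hst, dist_edist]
    exact ENNReal.toReal_mono (hbv s t hs ht)
      (eVariationOn.edist_le _ ⟨hs, le_rfl, hst⟩ ⟨ht, hst, le_rfl⟩)
  have hlip : LipschitzOnWith K v I := by
    refine LipschitzOnWith.of_dist_le_mul fun s hs t ht => ?_
    wlog hst : s ≤ t generalizing s t
    · rw [dist_comm, dist_comm s]
      exact this t ht s hs (le_of_not_ge hst)
    rw [dist_comm (v s), dist_comm s, Real.dist_eq, Real.dist_eq, abs_of_nonneg (sub_nonneg.2 hst),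
      hdiff s hs t ht hst, ENNReal.abs_toReal]
    have hle := (hK.mono inter_subset_left).comp_eVariationOn_le (mapsTo_id (I ∩ Set.Icc s t))
    have hid := hle.trans (mul_le_mul_right (eVariationOn.mono id inter_subset_right) (K : ℝ≥0∞))
    rw [eVariationOn_id_Icc, Function.comp_id] at hid
    refine (ENNReal.toReal_mono (by finiteness) hid).trans ?_
    simp [ENNReal.toReal_ofReal (sub_nonneg.2 hst)]
  have hv0 : v 0 = 0 := variationOnFromTo.self _ _ _
  have hvT : 0 ≤ v T := variationOnFromTo.nonneg_of_le _ _ hT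
  have hvL : v T ≤ L := by
    have hv : v T = (pathLength γ T).toReal := by
      rw [show v T = _ from variationOnFromTo.eq_of_le _ _ hT, inter_self]; rfl
    rw [hv]
    exact ENNReal.toReal_le_of_le_ofReal
      (le_of_lt (ENNReal.ofReal_pos.1 (bot_le.trans_lt hlt))) hlt.le
  have hsurj : ∀ u ∈ Set.Icc 0 (v T), ∃ t ∈ I, v t = u := by
    intro u hu
    rw [← hv0] at hu
    exact intermediate_value_Icc hT hlip.continuousOn hu
  choose! τ hτI hτ using hsurj
  have hproj : ∀ t : ℝ, (projIcc 0 (v T) hvT t : ℝ) ∈ Set.Icc 0 (v T) := fun t => Subtype.coe_prop _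
  refine ⟨fun t => γ (τ (projIcc 0 (v T) hvT t)), ?_, ?_, ?_, fun t _ => hS _ (hτI _ (hproj t))⟩
  · refine LipschitzWith.of_dist_le_mul fun s t => ?_
    refine (hdist _ (hτI _ (hproj s)) _ (hτI _ (hproj t))).trans ?_
    rw [hτ _ (hproj s), hτ _ (hproj t)]
    exact (LipschitzWith.projIcc hvT).dist_le_mul s t
  · refine dist_le_zero.1 ((hdist _ (hτI _ (hproj 0)) _ h0).trans ?_)
    rw [hτ _ (hproj 0), hv0, projIcc_left, dist_self]
  · refine dist_le_zero.1 ((hdist _ (hτI _ (hproj L)) _ hTI).trans ?_)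
    rw [hτ _ (hproj L), projIcc_of_right_le _ hvL, dist_self]

theorem JoinedAvoiding.trans {S : Set M} {x y z : M} {a b : ℝ} (ha : 0 ≤ a) (hb : 0 ≤ b)
    (hxy : JoinedAvoiding S x y a) (hyz : JoinedAvoiding S y z b) :
    JoinedAvoiding S x z (a + b) := by
  obtain ⟨G, hG, rfl, rfl, hGS⟩ := hxy
  obtain ⟨H, hH, hH0, rfl, hHS⟩ := hyz
  refine ⟨fun t => if t ≤ a then G t else H (t - a), ?_, by simp [ha], ?_, ?_⟩
  · refine LipschitzWith.of_dist_le_mul fun s t => ?_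
    wlog hst : s ≤ t generalizing s t
    · rw [dist_comm, dist_comm s]
      exact this t s (le_of_not_ge hst)
    by_cases hs : s ≤ a <;> by_cases ht : t ≤ a
    · simpa [hs, ht] using hG.dist_le_mul s t
    · have h₁ := hG.dist_le_mul s a
      have h₂ := hH.dist_le_mul 0 (t - a)
      have h₃ := dist_triangle (G s) (G a) (H (t - a))
      push Not at ht
      rw [NNReal.coe_one, one_mul, dist_comm s, Real.dist_eq, abs_of_nonneg (by linarith)] at h₁
      rw [hH0, NNReal.coe_one, one_mul, dist_comm 0, Real.dist_eq,
        abs_of_nonneg (by linarith)] at h₂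
      rw [if_pos hs, if_neg ht.not_ge, NNReal.coe_one, one_mul, dist_comm s, Real.dist_eq,
        abs_of_nonneg (by linarith)]
      linarith
    · exact absurd (hst.trans ht) hs
    · simpa [hs, ht] using hH.dist_le_mul (s - a) (t - a)
  · rcases hb.eq_or_lt with rfl | hb
    · simp [hH0]
    · simp [hb.not_ge]
  · intro t ht
    by_cases hta : t ≤ a
    · simpa [hta] using hGS t ⟨ht.1, hta⟩
    · simpa [hta] using hHS (t - a) ⟨by linarith, by linarith [ht.2]⟩

/-- Compactness of paths: paths of bounded length avoiding increasing open sets `S k` have a limit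
path avoiding `⋃ k, S k`. -/
theorem JoinedAvoiding.limit [ProperSpace M] {S : ℕ → Set M} (hmono : Monotone S)
    (hopen : ∀ k, IsOpen (S k)) {x : ℕ → M} {x₀ y : M} (hx : Tendsto x atTop (nhds x₀)) {L : ℝ}
    (h : ∀ k, JoinedAvoiding (S k) (x k) y L) : JoinedAvoiding (⋃ k, S k) x₀ y L := by
  choose G hG hG0 hGL hGS using h
  let U : Ultrafilter ℕ := hyperfilter ℕ
  have hU : (U : Filter ℕ) ≤ atTop := Nat.hyperfilter_le_atTop
  have hlim : ∀ t, ∃ z, Tendsto (fun k => G k t) U (nhds z) := by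
    intro t
    have hmem : ∀ k, G k t ∈ closedBall y (dist t L) := fun k => by
      simpa [hGL] using (hG k).dist_le_mul t L
    obtain ⟨z, -, hz⟩ := (isCompact_closedBall y (dist t L)).ultrafilter_le_nhds
      (U.map fun k => G k t)
      (le_principal_iff.2 (Filter.univ_mem' (f := (U : Filter ℕ)) hmem))
    exact ⟨z, hz⟩
  choose F hF using hlim
  refine ⟨F, ?_, ?_, ?_, ?_⟩
  · exact LipschitzWith.of_dist_le_mul fun s t =>
      le_of_tendsto ((hF s).dist (hF t)) (Eventually.of_forall fun k => (hG k).dist_le_mul s t)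
  · refine tendsto_nhds_unique (hF 0) ?_
    simpa [hG0] using hx.mono_left hU
  · refine tendsto_nhds_unique (hF L) ?_
    simp [hGL]
  · intro t ht hmem
    obtain ⟨n, hn⟩ := mem_iUnion.1 hmem
    obtain ⟨k, hk, hnk⟩ := (((hF t).eventually ((hopen n).mem_nhds hn)).and
      (hU (eventually_ge_atTop n))).exists
    exact hGS k t ht (hmono hnk hk)

theorem isClosed_dCompl_le [ProperSpace M] {S : Set M} (hS : IsOpen S) (q : M) {f : M → ℝ}
    (hf : Continuous f) (hf0 : ∀ x, 0 ≤ f x) :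
    IsClosed {x | dCompl S x q ≤ ENNReal.ofReal (f x)} := by
  refine IsSeqClosed.isClosed fun x x₀ hx hlim => ?_
  refine ENNReal.le_of_forall_pos_le_add fun ε hε _ => ?_
  have hpos : 0 ≤ f x₀ + ε := add_nonneg (hf0 _) ε.coe_nonneg
  rw [← ENNReal.ofReal_coe_nnreal, ← ENNReal.ofReal_add (hf0 _) ε.coe_nonneg]
  have hlt : ∀ᶠ k in atTop, f (x k) < f x₀ + ε :=
    ((hf.tendsto x₀).comp hlim).eventually_lt_const (lt_add_of_pos_right _ (NNReal.coe_pos.2 hε))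
  obtain ⟨N, hN⟩ := eventually_atTop.1 hlt
  have hjoin : ∀ k, JoinedAvoiding S (x (k + N)) q (f x₀ + ε) := fun k =>
    .of_dCompl_lt ((hx _).trans_lt ((ENNReal.ofReal_lt_ofReal_iff_of_nonneg (hf0 _)).2
      (hN _ (Nat.le_add_left N k))))
  have := JoinedAvoiding.limit (S := fun _ => S) monotone_const (fun _ => hS)
    (hlim.comp (tendsto_add_atTop_nat N)) hjoin
  rw [iUnion_const] at this
  exact this.dCompl_le hpos

theorem IsLengthSpace.joinedAvoiding_empty (hM : IsLengthSpace M) {x y : M} {L : ℝ}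
    (h : dist x y < L) : JoinedAvoiding ∅ x y L :=
  .of_dCompl_lt (by
    rw [← hM]
    exact (ENNReal.ofReal_lt_ofReal_iff_of_nonneg dist_nonneg).2 h)

theorem IsLengthSpace.joinedAvoiding_of_disjoint_ball (hM : IsLengthSpace M) {S : Set M} {x y : M}
    {r L : ℝ} (hS : Disjoint (ball x r) S) (hL : dist y x < L) (hLr : L < r) :
    JoinedAvoiding S y x L := by
  obtain ⟨G, hG, h0, hGL, -⟩ := hM.joinedAvoiding_empty hL
  refine ⟨G, hG, h0, hGL, fun t ht => disjoint_left.1 hS ?_⟩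
  have := hG.dist_le_mul t L
  rw [hGL, NNReal.coe_one, one_mul, Real.dist_eq, abs_sub_comm,
    abs_of_nonneg (sub_nonneg.2 ht.2)] at this
  exact mem_ball.2 (by linarith [ht.1])

/-- A bound on `d_S(x, q)` propagates to the points of a ball about `x` that avoids `S`. -/
theorem IsLengthSpace.dCompl_le_add (hM : IsLengthSpace M) {S : Set M} {x y q : M} {r L c : ℝ}
    (hS : Disjoint (ball x r) S) (hL : dist y x < L) (hLr : L < r)
    (hc : 0 ≤ c) (hxq : dCompl S x q ≤ ENNReal.ofReal c) :
    dCompl S y q ≤ ENNReal.ofReal (L + c) := by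
  have hL0 : 0 ≤ L := dist_nonneg.trans hL.le
  refine ENNReal.le_of_forall_pos_le_add fun ε hε _ => ?_
  have hε' : (0 : ℝ) < ε := NNReal.coe_pos.2 hε
  rw [← ENNReal.ofReal_coe_nnreal, ← ENNReal.ofReal_add (by positivity) ε.coe_nonneg, add_assoc]
  refine ((hM.joinedAvoiding_of_disjoint_ball hS hL hLr).trans hL0 (by positivity)
    (.of_dCompl_lt (hxq.trans_lt ?_))).dCompl_le (by positivity)
  exact (ENNReal.ofReal_lt_ofReal_iff_of_nonneg hc).2 (by linarith)

theorem monotone_omegaSeq (p q : M) (lam : ℝ) : Monotone (OmegaSeq p q lam) :=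
  monotone_nat_of_le_succ fun _ => subset_union_left

theorem omega_eq_iUnion (p q : M) (lam : ℝ) : Omega p q lam = ⋃ n, OmegaSeq p q lam n :=
  (monotone_omegaSeq p q lam).iUnion_nat_add 1

theorem dCompl_omegaSeq_le {p q x : M} {lam : ℝ} (hx : x ∉ Omega p q lam) (n : ℕ) :
    dCompl (OmegaSeq p q lam n) x q ≤ ENNReal.ofReal (lam * dist x p) := by
  by_contra! h
  rw [omega_eq_iUnion, mem_iUnion, not_exists] at hx
  exact hx (n + 1) (Or.inr ⟨hx n, h⟩)

theorem isOpen_omegaSeq [ProperSpace M] (p q : M) {lam : ℝ} (hlam : 0 ≤ lam) (n : ℕ) :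
    IsOpen (OmegaSeq p q lam n) := by
  induction n with
  | zero => exact isOpen_empty
  | succ n ih =>
    have hunion : OmegaSeq p q lam (n + 1) = OmegaSeq p q lam n ∪
        {x | dCompl (OmegaSeq p q lam n) x q ≤ ENNReal.ofReal (lam * dist x p)}ᶜ := by
      ext x
      by_cases hx : x ∈ OmegaSeq p q lam n <;> simp [OmegaSeq, hx]
    rw [hunion]
    exact ih.union (isClosed_dCompl_le ih q (by fun_prop) fun x => by positivity).isOpen_compl

theorem isOpen_omega [ProperSpace M] (p q : M) {lam : ℝ} (hlam : 0 ≤ lam) :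
    IsOpen (Omega p q lam) :=
  isOpen_iUnion fun n => isOpen_omegaSeq p q hlam (n + 1)

theorem dCompl_anti {S S' : Set M} (h : S ⊆ S') (x y : M) : dCompl S x y ≤ dCompl S' x y := by
  refine sInf_le_sInf ?_
  rintro L ⟨T, γ, hT, h0, h1, hK, hS, hL⟩
  exact ⟨T, γ, hT, h0, h1, hK, fun t ht hmem => hS t ht (h hmem), hL⟩

theorem mem_omega_self (hM : IsLengthSpace M) {p q : M} (hpq : p ≠ q) (lam : ℝ) :
    p ∈ Omega p q lam := by
  refine mem_iUnion.2 ⟨0, Or.inr ⟨notMem_empty p, ?_⟩⟩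
  rw [show OmegaSeq p q lam 0 = ∅ from rfl, ← hM]
  simpa using hpq

theorem dCompl_omega_le [ProperSpace M] {p q x : M} {lam : ℝ} (hlam : 0 ≤ lam)
    (hx : x ∉ Omega p q lam) :
    dCompl (Omega p q lam) x q ≤ ENNReal.ofReal (lam * dist x p) := by
  have hpos : 0 ≤ lam * dist x p := by positivity
  refine ENNReal.le_of_forall_pos_le_add fun ε hε _ => ?_
  have hε' : (0 : ℝ) < ε := NNReal.coe_pos.2 hε
  rw [← ENNReal.ofReal_coe_nnreal, ← ENNReal.ofReal_add hpos ε.coe_nonneg, omega_eq_iUnion]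
  refine (JoinedAvoiding.limit (monotone_omegaSeq p q lam) (isOpen_omegaSeq p q hlam)
    tendsto_const_nhds fun k => .of_dCompl_lt
      ((dCompl_omegaSeq_le hx k).trans_lt ?_)).dCompl_le (by positivity)
  exact (ENNReal.ofReal_lt_ofReal_iff_of_nonneg hpos).2 (by linarith)

theorem le_dCompl_omega_of_mem_closure (hM : IsLengthSpace M) {p q x : M} {lam : ℝ}
    (hlam : 0 ≤ lam) (hx : x ∈ closure (Omega p q lam)) :
    ENNReal.ofReal (lam * dist x p) ≤ dCompl (Omega p q lam) x q := by
  by_contra! hlt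
  obtain ⟨c, hc0, hc, hclt⟩ : ∃ c : ℝ, 0 ≤ c ∧ dCompl (Omega p q lam) x q = ENNReal.ofReal c ∧
      c < lam * dist x p := by
    refine ⟨_, ENNReal.toReal_nonneg, (ENNReal.ofReal_toReal hlt.ne_top).symm, ?_⟩
    exact (ENNReal.lt_ofReal_iff_toReal_lt hlt.ne_top).1 hlt
  obtain ⟨ε, hε, hεlt⟩ : ∃ ε : ℝ, 0 < ε ∧ (lam + 1) * ε < lam * dist x p - c := by
    refine ⟨(lam * dist x p - c) / (2 * (lam + 1)), div_pos (by linarith) (by positivity), ?_⟩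
    rw [← mul_div_assoc, div_lt_iff₀ (by positivity)]
    nlinarith
  have hex : ∃ n, (ball x ε ∩ OmegaSeq p q lam n).Nonempty := by
    obtain ⟨y, hyb, hy⟩ := mem_closure_iff_nhds.1 hx _ (ball_mem_nhds x hε)
    rw [omega_eq_iUnion] at hy
    obtain ⟨n, hn⟩ := mem_iUnion.1 hy
    exact ⟨n, y, hyb, hn⟩
  obtain ⟨n, hn, hmin⟩ : ∃ n, (ball x ε ∩ OmegaSeq p q lam (n + 1)).Nonempty ∧
      Disjoint (ball x ε) (OmegaSeq p q lam n) := by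
    have hne : Nat.find hex ≠ 0 := fun h0 => by
      have := Nat.find_spec hex
      rw [h0] at this
      simp [OmegaSeq] at this
    obtain ⟨n, hn⟩ := Nat.exists_eq_succ_of_ne_zero hne
    refine ⟨n, by simpa only [hn] using Nat.find_spec hex, ?_⟩
    rw [disjoint_iff_inter_eq_empty, ← not_nonempty_iff_eq_empty]
    exact Nat.find_min hex (by omega)
  obtain ⟨y, hyb, hy⟩ := hn
  have hylt : ENNReal.ofReal (lam * dist y p) < dCompl (OmegaSeq p q lam n) y q :=
    (hy.resolve_left (disjoint_left.1 hmin hyb)).2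
  obtain ⟨L, hL, hLε⟩ := exists_between (mem_ball.1 hyb)
  have hsub : OmegaSeq p q lam n ⊆ Omega p q lam :=
    omega_eq_iUnion p q lam ▸ subset_iUnion _ n
  have hle := hM.dCompl_le_add hmin hL hLε hc0 ((dCompl_anti hsub x q).trans_eq hc)
  have hreal : lam * dist y p < L + c :=
    (ENNReal.ofReal_lt_ofReal_iff_of_nonneg (by positivity)).1 (hylt.trans_le hle)
  have htri := dist_triangle x y p
  rw [dist_comm x y] at htri
  nlinarith [mul_le_mul_of_nonneg_left htri hlam, mul_le_mul_of_nonneg_left hL.le hlam,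
    mul_le_mul_of_nonneg_left hLε.le hlam]

theorem mem_closure_omega_of_le_dCompl [ProperSpace M] (hM : IsLengthSpace M) {p q x : M}
    (hpq : p ≠ q) {lam : ℝ} (hlam : 1 < lam)
    (hx : ENNReal.ofReal (lam * dist x p) ≤ dCompl (Omega p q lam) x q) :
    x ∈ closure (Omega p q lam) := by
  by_contra hcl
  have hxp : 0 < dist x p :=
    dist_pos.2 fun h => hcl (subset_closure (h ▸ mem_omega_self hM hpq lam))
  obtain ⟨r, hr, hball⟩ := Metric.mem_nhds_iff.1 (isClosed_closure.isOpen_compl.mem_nhds hcl)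
  have hdisj : Disjoint (ball x r) (Omega p q lam) :=
    disjoint_left.2 fun y hy hmem => hball hy (subset_closure hmem)
  set s := min (r / 4) (dist x p)
  have hs : 0 < s := lt_min (by linarith) hxp
  have hsr : s ≤ r / 4 := min_le_left _ _
  have hsD : s ≤ dist x p := min_le_right _ _
  obtain ⟨δ, hδ, hδs, hδlt⟩ : ∃ δ : ℝ, 0 < δ ∧ δ < s ∧ (lam + 1) * δ < (lam - 1) * s := by
    refine ⟨(lam - 1) * s / (2 * (lam + 1)), div_pos (by nlinarith) (by linarith), ?_, ?_⟩
    · rw [div_lt_iff₀ (by linarith)]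
      nlinarith
    · rw [← mul_div_assoc, div_lt_iff₀ (by linarith)]
      nlinarith [mul_pos (mul_pos (sub_pos.2 hlam) hs) (by linarith : 0 < lam + 1)]
  obtain ⟨G, hG, hG0, hGL, -⟩ := hM.joinedAvoiding_empty (lt_add_of_pos_right (dist x p) hδ)
  have hxy : dist x (G s) ≤ s := by
    have := hG.dist_le_mul 0 s
    simpa [hG0, Real.dist_eq, abs_of_pos hs] using this
  have hyp : dist (G s) p ≤ dist x p + δ - s := by
    have := hG.dist_le_mul s (dist x p + δ)
    rwa [hGL, NNReal.coe_one, one_mul, Real.dist_eq, abs_sub_comm,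
      abs_of_nonneg (by linarith)] at this
  have hball' : ball (G s) (r / 2) ⊆ ball x r :=
    ball_subset_ball' (by rw [dist_comm]; linarith)
  have hy : G s ∉ Omega p q lam :=
    disjoint_left.1 hdisj (hball' (mem_ball_self (by linarith)))
  have hle := hM.dCompl_le_add (hdisj.mono_left hball')
    (by linarith : dist x (G s) < s + δ) (by linarith) (by positivity)
    (dCompl_omega_le (by linarith) hy)
  have hreal : lam * dist x p ≤ s + δ + lam * dist (G s) p :=
    (ENNReal.ofReal_le_ofReal_iff (by positivity)).1 (hx.trans hle)
  nlinarith [mul_le_mul_of_nonneg_left hyp (by linarith : 0 ≤ lam)]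

/-- Lemma 2.6.  For all `x ∈ M ∖ Ω`,
`d_Ω(x,q) ≤ λ d(x,p)`, with equality if and only if `x ∈ ∂Ω`. -/
theorem omega_key_property
    {M : Type*} [MetricSpace M] [ProperSpace M] (hM : IsLengthSpace M)
    (p q : M) (hpq : p ≠ q) (lam : ℝ) (hlam : 1 < lam) :
    ∀ x : M, x ∉ Omega p q lam →
      dCompl (Omega p q lam) x q ≤ ENNReal.ofReal (lam * dist x p) ∧
      (dCompl (Omega p q lam) x q = ENNReal.ofReal (lam * dist x p) ↔
        x ∈ frontier (Omega p q lam)) := by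
  have hlam0 : 0 ≤ lam := by linarith
  intro x hx
  refine ⟨dCompl_omega_le hlam0 hx, fun h => ?_, fun h => ?_⟩
  · rw [(isOpen_omega p q hlam0).frontier_eq]
    exact ⟨mem_closure_omega_of_le_dCompl hM hpq hlam h.ge, hx⟩
  · exact (dCompl_omega_le hlam0 hx).antisymm
      (le_dCompl_omega_of_mem_closure hM hlam0 (frontier_subset_closure h))

end GrowthComp
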